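/- Fix an integer γ ≥ 1 and let S ⊂ ℝ² consist of the red points (i, 1/2) and the blue points (i, −1/2) for i ∈ {1,…,γ}. Then: (a) for all i, j ∈ {1,…,γ} with i ≠ j and every ρ > 0, if the red point (j,1/2) lies in the open ball B((i,1/2), ρ), then the blue point (i,−1/2) also lies in B((i,1/2), ρ) (and symmetrically with colors exchanged); (b) consequently, every finite family of open balls centered at points of S, none containing a point of S of label opposite to its center, and such that every point of S lies in some ball of the family with same-label center, has at least 2γ balls. -/

import Mathlib

noncomputable section
open Classical

/-- The Euclidean plane. -/
abbrev Pt := EuclideanSpace ℝ (Fin 2)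

/-- The point `(a, b)` of the Euclidean plane. -/
def pt (a b : ℝ) : Pt := (WithLp.equiv 2 (Fin 2 → ℝ)).symm ![a, b]

/-- The red points `(i, 1/2)` for `i ∈ {1,…,γ}`. -/
def RedS (γ : ℕ) : Finset Pt := (Finset.Icc 1 γ).image fun i => pt (i : ℝ) (1 / 2)

/-- The blue points `(i, -1/2)` for `i ∈ {1,…,γ}`. -/
def BlueS (γ : ℕ) : Finset Pt := (Finset.Icc 1 γ).image fun i => pt (i : ℝ) (-(1 / 2))

/-- Labels: `true` for red, `false` for blue. -/
def labS (γ : ℕ) : Pt → Bool := fun x => if x ∈ RedS γ then true else false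

theorem dist_pt (a b c d : ℝ) :
    dist (pt a b) (pt c d) = Real.sqrt ((a - c) ^ 2 + (b - d) ^ 2) := by
  simp [pt, EuclideanSpace.dist_eq, Real.dist_eq]

theorem pt_inj {a b c d : ℝ} : pt a b = pt c d ↔ a = c ∧ b = d := by
  simp [pt]

/-- A ball centered at `(i, y)` that reaches another point `(j, y)` at integer distance also
reaches the reflection `(i, -y)`, provided `|y| = 1/2`. -/
theorem pt_neg_mem_ball {i j : ℕ} (hij : i ≠ j) {y ρ : ℝ} (hy : y ^ 2 = 1 / 4)
    (h : pt j y ∈ Metric.ball (pt i y) ρ) : pt i (-y) ∈ Metric.ball (pt i y) ρ := by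
  rw [Metric.mem_ball, dist_pt] at h ⊢
  refine lt_of_le_of_lt (Real.sqrt_le_sqrt ?_) h
  have hz : (1 : ℤ) ≤ ((j : ℤ) - i) ^ 2 :=
    Int.add_one_le_iff.mpr (sq_pos_of_ne_zero (by lia))
  have hr : (1 : ℝ) ≤ ((j : ℝ) - i) ^ 2 := by exact_mod_cast hz
  nlinarith

theorem RedS_eq_image (γ : ℕ) :
    RedS γ = (Finset.Icc 1 γ).image fun i : ℕ => pt (i : ℝ) (1 / 2) := by
  ext p
  simp [RedS, Finset.bind_def]

theorem BlueS_eq_image (γ : ℕ) :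
    BlueS γ = (Finset.Icc 1 γ).image fun i : ℕ => pt (i : ℝ) (-(1 / 2)) := by
  ext p
  simp [BlueS, Finset.bind_def]

theorem mem_RedS {γ : ℕ} {p : Pt} :
    p ∈ RedS γ ↔ ∃ i ∈ Finset.Icc 1 γ, pt (i : ℝ) (1 / 2) = p := by
  simp only [RedS_eq_image, Finset.mem_image]

theorem mem_BlueS {γ : ℕ} {p : Pt} :
    p ∈ BlueS γ ↔ ∃ i ∈ Finset.Icc 1 γ, pt (i : ℝ) (-(1 / 2)) = p := by
  simp only [BlueS_eq_image, Finset.mem_image]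

theorem disjoint_RedS_BlueS (γ : ℕ) : Disjoint (RedS γ) (BlueS γ) := by
  rw [Finset.disjoint_left]
  intro p hp hq
  obtain ⟨i, -, rfl⟩ := mem_RedS.mp hp
  obtain ⟨j, -, h⟩ := mem_BlueS.mp hq
  have := (pt_inj.mp h).2
  norm_num at this

theorem labS_of_mem_RedS {γ : ℕ} {p : Pt} (hp : p ∈ RedS γ) : labS γ p = true := by
  simp [labS, hp]

theorem labS_of_mem_BlueS {γ : ℕ} {p : Pt} (hp : p ∈ BlueS γ) : labS γ p = false := by
  simp [labS, Finset.disjoint_right.mp (disjoint_RedS_BlueS γ) hp]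

theorem injective_pt_natCast (y : ℝ) : Function.Injective fun i : ℕ => pt (i : ℝ) y :=
  fun _ _ h => Nat.cast_injective (pt_inj.mp h).1

theorem card_RedS_union_BlueS (γ : ℕ) : (RedS γ ∪ BlueS γ).card = 2 * γ := by
  rw [Finset.card_union_of_disjoint (disjoint_RedS_BlueS γ), RedS_eq_image, BlueS_eq_image,
    Finset.card_image_of_injective _ (injective_pt_natCast _),
    Finset.card_image_of_injective _ (injective_pt_natCast _), Nat.card_Icc]
  lia

/-- A ball centered in the dataset that avoids all points of the opposite label contains no
point of its own label other than its center. -/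
theorem eq_center_of_mem_ball {γ : ℕ} {c p : Pt} {r : ℝ} (hc : c ∈ RedS γ ∪ BlueS γ)
    (hp : p ∈ RedS γ ∪ BlueS γ)
    (hcons : ∀ q ∈ RedS γ ∪ BlueS γ, labS γ q ≠ labS γ c → q ∉ Metric.ball c r)
    (hlab : labS γ c = labS γ p) (hmem : p ∈ Metric.ball c r) : c = p := by
  rcases Finset.mem_union.mp hc with hc | hc <;> rcases Finset.mem_union.mp hp with hp | hp
  · obtain ⟨i, hi, rfl⟩ := mem_RedS.mp hc
    obtain ⟨j, -, rfl⟩ := mem_RedS.mp hp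
    by_contra hne
    have hq : pt (i : ℝ) (-(1 / 2)) ∈ BlueS γ := mem_BlueS.mpr ⟨i, hi, rfl⟩
    refine hcons _ (Finset.mem_union_right _ hq) ?_
      (pt_neg_mem_ball (fun h => hne (by rw [h])) (by norm_num) hmem)
    rw [labS_of_mem_RedS hc, labS_of_mem_BlueS hq]
    decide
  · simp [labS_of_mem_RedS hc, labS_of_mem_BlueS hp] at hlab
  · simp [labS_of_mem_BlueS hc, labS_of_mem_RedS hp] at hlab
  · obtain ⟨i, hi, rfl⟩ := mem_BlueS.mp hc
    obtain ⟨j, -, rfl⟩ := mem_BlueS.mp hp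
    by_contra hne
    have hq : pt (i : ℝ) (1 / 2) ∈ RedS γ := mem_RedS.mpr ⟨i, hi, rfl⟩
    refine hcons _ (Finset.mem_union_left _ hq) ?_ ?_
    · rw [labS_of_mem_BlueS hc, labS_of_mem_RedS hq]
      decide
    · simpa only [neg_neg] using
        pt_neg_mem_ball (fun h => hne (by rw [h])) (by norm_num) hmem

/-- (a) Any open ball centered at a point of the dataset that contains a distinct
same-labeled point also contains the oppositely-labeled point directly across; (b)
consequently any consistent same-label ball cover of the dataset (encoded as a finite
set of (center, radius) pairs) has at least `2γ` balls. -/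
theorem stmt11 (γ : ℕ) (hγ : 1 ≤ γ) :
    (∀ i ∈ Finset.Icc 1 γ, ∀ j ∈ Finset.Icc 1 γ, i ≠ j → ∀ ρ : ℝ, 0 < ρ →
      (pt (j : ℝ) (1 / 2) ∈ Metric.ball (pt (i : ℝ) (1 / 2)) ρ →
        pt (i : ℝ) (-(1 / 2)) ∈ Metric.ball (pt (i : ℝ) (1 / 2)) ρ) ∧
      (pt (j : ℝ) (-(1 / 2)) ∈ Metric.ball (pt (i : ℝ) (-(1 / 2))) ρ →
        pt (i : ℝ) (1 / 2) ∈ Metric.ball (pt (i : ℝ) (-(1 / 2))) ρ)) ∧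
    (∀ F : Finset (Pt × ℝ),
      (∀ cr ∈ F, cr.1 ∈ RedS γ ∪ BlueS γ ∧
        ∀ p ∈ RedS γ ∪ BlueS γ, labS γ p ≠ labS γ cr.1 →
          p ∉ Metric.ball cr.1 cr.2) →
      (∀ p ∈ RedS γ ∪ BlueS γ, ∃ cr ∈ F, labS γ cr.1 = labS γ p ∧
        p ∈ Metric.ball cr.1 cr.2) →
      2 * γ ≤ F.card) := by
  refine ⟨fun i _ j _ hij ρ _ => ⟨pt_neg_mem_ball hij (by norm_num), fun h => ?_⟩,
    fun F hF hcover => ?_⟩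
  · simpa only [neg_neg] using pt_neg_mem_ball hij (by norm_num) h
  · have hsub : RedS γ ∪ BlueS γ ⊆ F.image Prod.fst := by
      intro p hp
      obtain ⟨cr, hcr, hlab, hmem⟩ := hcover p hp
      exact Finset.mem_image.mpr
        ⟨cr, hcr, eq_center_of_mem_ball (hF cr hcr).1 hp (hF cr hcr).2 hlab hmem⟩
    rw [← card_RedS_union_BlueS γ]
    exact (Finset.card_le_card hsub).trans Finset.card_image_le
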